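/- arXiv:2410.04213 — 6 statements merged into one kernel-verified Lean document; each statement's English description precedes it below -/
import Mathlib

section
/- Let f(·; U) : ℝ^{n_0} → ℝ^{n_L} be the ReLU multilayer perceptron with parameters U, defined by z^(0) := x, z^(i) := σ(W^(i)·z^(i−1) + b^(i)) for 1 ≤ i ≤ L−1, and f(x; U) := W^(L)·z^(L−1) + b^(L), where σ applies t ↦ max(t, 0) coordinatewise. Then for every g ∈ G, every weight-space element U, and every x ∈ ℝ^{n_0}, one has f(x; gU) = f(x; U). -/
open Matrix

noncomputable section

/-- The ReLU activation `t ↦ max(t, 0)`. -/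
def relu (t : ℝ) : ℝ := max t 0

/-- The hidden activations of a ReLU MLP: `z^(0) = x`,
`z^(i) = σ(W^(i) · z^(i-1) + b^(i))` with `σ = ReLU` applied coordinatewise. -/
def hiddenLayer (n : ℕ → ℕ) (W : ∀ i : ℕ, Matrix (Fin (n i)) (Fin (n (i - 1))) ℝ)
    (b : ∀ i : ℕ, Fin (n i) → ℝ) (x : Fin (n 0) → ℝ) : ∀ i : ℕ, Fin (n i) → ℝ
  | 0 => x
  | i + 1 => fun j => relu ((W (i + 1)).mulVec (hiddenLayer n W b x i) j + b (i + 1) j)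

/-- The ReLU MLP `f(x ; U) = W^(L) · z^(L-1) + b^(L)`. -/
def mlp (L : ℕ) (n : ℕ → ℕ) (W : ∀ i : ℕ, Matrix (Fin (n i)) (Fin (n (i - 1))) ℝ)
    (b : ∀ i : ℕ, Fin (n i) → ℝ) (x : Fin (n 0) → ℝ) : Fin (n L) → ℝ :=
  (W L).mulVec (hiddenLayer n W b x (L - 1)) + b L

/-- The group `G`: tuples `g = (g^(L), …, g^(0))` of invertible matrices with
`g^(L) = I`, `g^(0) = I`, and `g^(i)` a product of a positive diagonal matrix and a
permutation matrix for `0 < i < L`. -/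
def IsInG (L : ℕ) (n : ℕ → ℕ) (g : ∀ i : ℕ, GL (Fin (n i)) ℝ) : Prop :=
  ((g L : Matrix (Fin (n L)) (Fin (n L)) ℝ) = 1) ∧
  ((g 0 : Matrix (Fin (n 0)) (Fin (n 0)) ℝ) = 1) ∧
  ∀ i : ℕ, 0 < i → i < L →
    ∃ (d : Fin (n i) → ℝ) (π : Equiv.Perm (Fin (n i))),
      (∀ j, 0 < d j) ∧
      (g i : Matrix (Fin (n i)) (Fin (n i)) ℝ) = Matrix.diagonal d * π.permMatrix ℝ

/-- The action of `g` on the weights: `[gW]^(i) = g^(i) · W^(i) · (g^(i-1))⁻¹`. -/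
def actW (n : ℕ → ℕ) (g : ∀ i : ℕ, GL (Fin (n i)) ℝ)
    (W : ∀ i : ℕ, Matrix (Fin (n i)) (Fin (n (i - 1))) ℝ) (i : ℕ) :
    Matrix (Fin (n i)) (Fin (n (i - 1))) ℝ :=
  (g i : Matrix (Fin (n i)) (Fin (n i)) ℝ) * W i *
    (((g (i - 1))⁻¹ : GL (Fin (n (i - 1))) ℝ) : Matrix (Fin (n (i - 1))) (Fin (n (i - 1))) ℝ)

/-- The action of `g` on the biases: `[gb]^(i) = g^(i) · b^(i)`. -/
def actb (n : ℕ → ℕ) (g : ∀ i : ℕ, GL (Fin (n i)) ℝ)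
    (b : ∀ i : ℕ, Fin (n i) → ℝ) (i : ℕ) : Fin (n i) → ℝ :=
  (g i : Matrix (Fin (n i)) (Fin (n i)) ℝ).mulVec (b i)

/-- ReLU commutes with multiplication by a nonnegative scalar. -/
lemma relu_mul_of_nonneg {c : ℝ} (hc : 0 ≤ c) (t : ℝ) : relu (c * t) = c * relu t := by
  simp [relu, mul_max_of_nonneg _ _ hc]

/-- Coordinatewise ReLU commutes with a nonnegative diagonal matrix times a permutation matrix. -/
lemma relu_diagonal_mul_permMatrix_mulVec {m : ℕ} {d : Fin m → ℝ} (hd : ∀ j, 0 ≤ d j)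
    (π : Equiv.Perm (Fin m)) (v : Fin m → ℝ) :
    (fun j => relu ((Matrix.diagonal d * π.permMatrix ℝ).mulVec v j)) =
      (Matrix.diagonal d * π.permMatrix ℝ).mulVec (fun j => relu (v j)) := by
  funext j
  simp only [← Matrix.mulVec_mulVec, Matrix.mulVec_diagonal, Matrix.permMatrix_mulVec,
    Function.comp_apply]
  exact relu_mul_of_nonneg (hd j) _

/-- The transformed weights at layer `i` send `g^(i-1) · v` to `g^(i) · W^(i) · v`. -/
lemma actW_mulVec_mulVec (n : ℕ → ℕ) (g : ∀ i : ℕ, GL (Fin (n i)) ℝ)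
    (W : ∀ i : ℕ, Matrix (Fin (n i)) (Fin (n (i - 1))) ℝ) (i : ℕ)
    (v : Fin (n (i - 1)) → ℝ) :
    (actW n g W i).mulVec ((g (i - 1)).val.mulVec v) = (g i).val.mulVec ((W i).mulVec v) := by
  rw [actW, Matrix.mulVec_mulVec, Matrix.mul_assoc, Units.inv_mul, Matrix.mul_one,
    Matrix.mulVec_mulVec]

/-- The hidden activations are `G`-equivariant. -/
lemma hiddenLayer_act {L : ℕ} {n : ℕ → ℕ} {g : ∀ i : ℕ, GL (Fin (n i)) ℝ} (hg : IsInG L n g)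
    (W : ∀ i : ℕ, Matrix (Fin (n i)) (Fin (n (i - 1))) ℝ)
    (b : ∀ i : ℕ, Fin (n i) → ℝ) (x : Fin (n 0) → ℝ) (i : ℕ) (hi : i < L) :
    hiddenLayer n (actW n g W) (actb n g b) x i =
      (g i).val.mulVec (hiddenLayer n W b x i) := by
  induction i with
  | zero => simp [hiddenLayer, hg.2.1]
  | succ i ih =>
    obtain ⟨d, π, hd, hgi⟩ := hg.2.2 (i + 1) i.succ_pos hi
    have key : (actW n g W (i + 1)).mulVec (hiddenLayer n (actW n g W) (actb n g b) x i) +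
        actb n g b (i + 1) = (g (i + 1)).val.mulVec
          ((W (i + 1)).mulVec (hiddenLayer n W b x i) + b (i + 1)) := by
      rw [ih (by omega), Matrix.mulVec_add, actb]
      exact congrArg (· + _) (actW_mulVec_mulVec n g W (i + 1) _)
    have equivariant := relu_diagonal_mul_permMatrix_mulVec (fun j => (hd j).le) π
      ((W (i + 1)).mulVec (hiddenLayer n W b x i) + b (i + 1))
    rw [← hgi, ← key] at equivariant
    exact equivariant

/-- the ReLU MLP is `G`-invariant in its weight space:
`f(x ; gU) = f(x ; U)` for every `g ∈ G`, every weight-space element `U` and every `x`. -/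
theorem mlp_G_invariant (L : ℕ) (hL : 1 ≤ L) (n : ℕ → ℕ) (hn : ∀ i, 1 ≤ n i)
    (g : ∀ i : ℕ, GL (Fin (n i)) ℝ) (hg : IsInG L n g)
    (W : ∀ i : ℕ, Matrix (Fin (n i)) (Fin (n (i - 1))) ℝ)
    (b : ∀ i : ℕ, Fin (n i) → ℝ) (x : Fin (n 0) → ℝ) :
    mlp L n (actW n g W) (actb n g b) x = mlp L n W b x := by
  rw [mlp, mlp, hiddenLayer_act hg W b x (L - 1) (by omega), actW_mulVec_mulVec, actb,
    hg.1, Matrix.one_mulVec, Matrix.one_mulVec]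
end
end

section
/- Let s, t, p, q be integers with L ≥ s > 0, L > t ≥ 0, 1 ≤ p ≤ n_s, 1 ≤ q ≤ n_t, and let Ψ ∈ ℝ^{n_0 × n_L}. If the (p,q) entry of the matrix 𝐖^(s,0) · Ψ · 𝐖^(L,t) is the zero polynomial in R, then Ψ = 0. -/
open Matrix MvPolynomial

noncomputable section

/-- Indeterminates: `Sum.inl (i, j, k)` is `x^(i)_{jk}` and `Sum.inr (i, j)` is `y^(i)_j`. -/
abbrev PVar : Type := (ℕ × ℕ × ℕ) ⊕ (ℕ × ℕ)

/-- The polynomial ring `R` with real coefficients in the indeterminates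
`x^(i)_{jk}` and `y^(i)_j`. -/
abbrev Rpoly : Type := MvPolynomial PVar ℝ

/-- The matrix `𝐖^(i)` of indeterminates, with `(j,k)` entry `x^(i)_{jk}`. -/
def Wm (n : ℕ → ℕ) (i : ℕ) : Matrix (Fin (n i)) (Fin (n (i - 1))) Rpoly :=
  Matrix.of fun j k => MvPolynomial.X (Sum.inl (i, (j : ℕ), (k : ℕ)))

/-- The column vector `𝐛^(i)` of indeterminates, with `j`-th entry `y^(i)_j`. -/
def bm (n : ℕ → ℕ) (i : ℕ) : Matrix (Fin (n i)) (Fin 1) Rpoly :=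
  Matrix.of fun j _ => MvPolynomial.X (Sum.inr (i, (j : ℕ)))

/-- The product `𝐖^(s,t) = 𝐖^(s) * 𝐖^(s-1) * ⋯ * 𝐖^(t+1)` of `s - t` matrices. -/
def WmProd (n : ℕ → ℕ) : (s : ℕ) → (t : ℕ) → Matrix (Fin (n s)) (Fin (n t)) Rpoly
  | s, t =>
    if _h : t < s then Wm n s * WmProd n (s - 1) t
    else Matrix.of fun i j => if (i : ℕ) = (j : ℕ) then (1 : Rpoly) else 0
termination_by s t => s
decreasing_by omega

/-- The entrywise inclusion of a real matrix into matrices over `R`. -/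
def toR {m k : Type*} (M : Matrix m k ℝ) : Matrix m k Rpoly :=
  M.map (MvPolynomial.C)

/-- The evaluation point at which `𝐖^(i)` becomes the rank-one matrix `α i ⬝ (β i)ᵀ`. -/
def rankOnePoint (α β : ℕ → ℕ → ℝ) : PVar → ℝ :=
  Sum.elim (fun x => α x.1 x.2.1 * β x.1 x.2.2) fun _ => 0

lemma WmProd_self (n : ℕ → ℕ) (t : ℕ) : WmProd n t t = 1 := by
  rw [WmProd, dif_neg (lt_irrefl t)]
  ext i j : 1
  simp [Matrix.one_apply, Fin.ext_iff]

lemma WmProd_succ_apply (n : ℕ → ℕ) {s t : ℕ} (h : t ≤ s) (j : Fin (n (s + 1)))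
    (k : Fin (n t)) :
    WmProd n (s + 1) t j k =
      ∑ l : Fin (n s), X (Sum.inl (s + 1, (j : ℕ), (l : ℕ))) * WmProd n s t l k := by
  rw [WmProd, dif_pos (Nat.lt_succ_of_le h)]
  rfl

/-- At a positive rank-one point, the products `𝐖^(s,t)` are positive rank-one matrices. -/
lemma exists_eval_WmProd_eq (n : ℕ → ℕ) (hn : ∀ i, 1 ≤ n i) {α β : ℕ → ℕ → ℝ}
    (hα : ∀ i j, 0 < α i j) (hβ : ∀ i j, 0 < β i j) {s t : ℕ} (hts : t + 1 ≤ s) :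
    ∃ c : ℝ, 0 < c ∧ ∀ (j : Fin (n s)) (k : Fin (n t)),
      eval (rankOnePoint α β) (WmProd n s t j k) = c * α s j * β (t + 1) k := by
  induction s, hts using Nat.le_induction with
  | base =>
    refine ⟨1, one_pos, fun j k => ?_⟩
    simp [WmProd_succ_apply n le_rfl, WmProd_self, Matrix.one_apply, rankOnePoint]
  | succ s hs ih =>
    obtain ⟨c, hc, hcs⟩ := ih
    have : Nonempty (Fin (n s)) := ⟨⟨0, hn s⟩⟩
    refine ⟨∑ l : Fin (n s), β (s + 1) l * (c * α s l),
      Finset.sum_pos (fun l _ => mul_pos (hβ _ _) (mul_pos hc (hα _ _)))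
        Finset.univ_nonempty, fun j k => ?_⟩
    rw [WmProd_succ_apply n (by omega), map_sum, Finset.sum_mul, Finset.sum_mul]
    refine Finset.sum_congr rfl fun l _ => ?_
    rw [map_mul, eval_X, hcs]
    simp only [rankOnePoint, Sum.elim_inl]
    ring

lemma eq_zero_of_forall_pos_sum_mul_eq_zero {m : ℕ} {w : Fin m → ℝ}
    (h : ∀ u : ℕ → ℝ, (∀ i, 0 < u i) → ∑ a : Fin m, u a * w a = 0) (a : Fin m) : w a = 0 := by
  have h₁ : ∑ x, w x = 0 := by simpa using h (fun _ => 1) fun _ => one_pos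
  have h₂ := h (fun i => 1 + if i = (a : ℕ) then 1 else 0) fun i => by positivity
  simpa [add_mul, Finset.sum_add_distrib, ← Fin.ext_iff, h₁] using h₂

/-- if an entry of `𝐖^(s,0) · Ψ · 𝐖^(L,t)` is the zero polynomial, then `Ψ = 0`. -/
theorem psi_eq_zero_of_entry_eq_zero (L : ℕ) (hL : 1 ≤ L) (n : ℕ → ℕ) (hn : ∀ i, 1 ≤ n i)
    (s t : ℕ) (hs : 0 < s) (hsL : s ≤ L) (htL : t < L)
    (p : Fin (n s)) (q : Fin (n t))
    (Ψ : Matrix (Fin (n 0)) (Fin (n L)) ℝ)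
    (h : (WmProd n s 0 * toR Ψ * WmProd n L t) p q = 0) :
    Ψ = 0 := by
  have key : ∀ u v : ℕ → ℝ, (∀ i, 0 < u i) → (∀ i, 0 < v i) →
      ∑ b : Fin (n L), v b * ∑ a : Fin (n 0), u a * Ψ a b = 0 := by
    intro u v hu hv
    let α : ℕ → ℕ → ℝ := fun i j => if i = L then v j else 1
    let β : ℕ → ℕ → ℝ := fun i k => if i = 1 then u k else 1
    have hα : ∀ i j, 0 < α i j := fun i j => by
      by_cases hi : i = L <;> simp [α, hi, hv]
    have hβ : ∀ i k, 0 < β i k := fun i k => by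
      by_cases hi : i = 1 <;> simp [β, hi, hu]
    obtain ⟨c, hc, hcs⟩ := exists_eval_WmProd_eq n hn hα hβ (s := s) (t := 0) hs
    obtain ⟨d, hd, hds⟩ := exists_eval_WmProd_eq n hn hα hβ (s := L) (t := t) htL
    have hpos : 0 < c * α s p * (d * β (t + 1) q) :=
      mul_pos (mul_pos hc (hα _ _)) (mul_pos hd (hβ _ _))
    refine (mul_eq_zero.mp ?_).resolve_left hpos.ne'
    have h0 := congrArg (eval (rankOnePoint α β)) h
    simp only [Matrix.mul_apply, map_sum, map_mul, hcs, hds, toR, Matrix.map_apply, eval_C,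
      map_zero] at h0
    rw [← h0, Finset.mul_sum]
    refine Finset.sum_congr rfl fun b _ => ?_
    rw [Finset.mul_sum, Finset.mul_sum, Finset.sum_mul]
    refine Finset.sum_congr rfl fun a _ => ?_
    have hβu : β (0 + 1) a = u a := by simp [β]
    have hαv : α L b = v b := by simp [α]
    rw [hβu, hαv]
    ring
  ext a b
  exact eq_zero_of_forall_pos_sum_mul_eq_zero (fun u hu =>
    eq_zero_of_forall_pos_sum_mul_eq_zero (fun v hv => key u v hu hv) b) a
end
end

section
/- Let s, t be integers with L ≥ s > t > 0, and let Φ_p ∈ ℝ for 1 ≤ p ≤ n_s. If Σ_{p=1}^{n_s} Φ_p · (𝐖^(s,t) · 𝐛^(t))_p = 0 in R, then Φ_p = 0 for all p. -/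
open Matrix MvPolynomial

noncomputable section

/-- If `x^(i)_{jk}` is sent to `a i j` for `k = 0` and to `0` otherwise, `y^(i)_j` is sent to
`a i j`, and `a i 0 = 1` for `t ≤ i < m`, then `𝐖^(m,t) * 𝐛^(t)` is sent to the vector `a m`. -/
theorem eval_WmProd_mul_bm (n : ℕ → ℕ) (hn : ∀ i, 1 ≤ n i) (a : ℕ → ℕ → ℝ) {t m : ℕ}
    (htm : t ≤ m) (ha : ∀ i, t ≤ i → i < m → a i 0 = 1) (p : Fin (n m)) :
    MvPolynomial.eval
      (Sum.elim (fun q : ℕ × ℕ × ℕ => if q.2.2 = 0 then a q.1 q.2.1 else 0) fun q => a q.1 q.2)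
      ((WmProd n m t * bm n t) p 0) = a m p := by
  induction m, htm using Nat.le_induction with
  | base =>
    have h1 : WmProd n t t = 1 := by
      rw [WmProd, dif_neg (lt_irrefl t)]
      ext i j
      simp [Matrix.one_apply, Fin.ext_iff]
    simp [h1, bm]
  | succ m htm ih =>
    have ih' := ih (fun i h₁ h₂ => ha i h₁ (by omega)) ⟨0, hn m⟩
    let W : Matrix (Fin (n (m + 1))) (Fin (n m)) Rpoly := Wm n (m + 1)
    have hW : WmProd n (m + 1) t = W * WmProd n m t := by
      rw [WmProd, dif_pos (by omega)]
      rfl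
    rw [hW, Matrix.mul_assoc, Matrix.mul_apply, map_sum]
    refine (Finset.sum_eq_single (⟨0, hn m⟩ : Fin (n m)) ?_ ?_).trans ?_
    · intro k _ hk
      have hk' : (k : ℕ) ≠ 0 := fun h => hk (Fin.ext h)
      simp [W, Wm, hk']
    · simp
    · rw [map_mul]
      refine (congrArg _ ih').trans ?_
      simp [W, Wm, ha m htm (by omega)]

/-- Lemma on `[𝐖𝐛]` terms. -/
theorem phi_eq_zero_of_Wb_combination (L : ℕ) (hL : 1 ≤ L) (n : ℕ → ℕ) (hn : ∀ i, 1 ≤ n i)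
    (s t : ℕ) (hts : t < s) (hsL : s ≤ L) (ht : 0 < t)
    (Φ : Fin (n s) → ℝ)
    (h : (∑ p, MvPolynomial.C (Φ p) * (WmProd n s t * bm n t) p 0) = (0 : Rpoly)) :
    ∀ p, Φ p = 0 := by
  intro p₀
  set a : ℕ → ℕ → ℝ := fun i j => if j = if i = s then (p₀ : ℕ) else 0 then 1 else 0 with ha
  have hev := eval_WmProd_mul_bm n hn a hts.le fun i _ hi => by simp [ha, hi.ne]
  have h' := congrArg (MvPolynomial.eval (Sum.elim
    (fun q : ℕ × ℕ × ℕ => if q.2.2 = 0 then a q.1 q.2.1 else 0) fun q => a q.1 q.2)) h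
  simp only [map_sum, map_mul, MvPolynomial.eval_C, map_zero, hev] at h'
  simpa [ha, ← Fin.ext_iff] using h'
end
end

section
/- Let s, t be integers with L ≥ s > 0 and L > t ≥ 0, let Ψ ∈ ℝ^{1 × n_L} be a row vector, and let Φ_{pq} ∈ ℝ for 1 ≤ p ≤ n_s, 1 ≤ q ≤ n_t. If Σ_{p=1}^{n_s} Σ_{q=1}^{n_t} Φ_{pq} · (𝐛^(s) · Ψ · 𝐖^(L,t))_{pq} = 0 in R, then either Φ_{pq} = 0 for all p, q, or Ψ = 0. -/
open Matrix MvPolynomial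

noncomputable section

/-- The point at which `𝐖^(i)` becomes the matrix unit at `(a i, a (i - 1))` and every bias
vector the standard basis vector at `b`. -/
def matrixUnitPoint (a : ℕ → ℕ) (b : ℕ) : PVar → ℝ
  | Sum.inl (i, j, k) => if j = a i ∧ k = a (i - 1) then 1 else 0
  | Sum.inr (_, j) => if j = b then 1 else 0

theorem eval_matrixUnitPoint_Wm_mul {m : Type*} (n a : ℕ → ℕ) (ha : ∀ i, a i < n i) (b i : ℕ)
    (M : Matrix (Fin (n (i - 1))) m Rpoly) (p : Fin (n i)) (q : m) :
    eval (matrixUnitPoint a b) ((Wm n i * M) p q) =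
      if (p : ℕ) = a i then eval (matrixUnitPoint a b) (M ⟨a (i - 1), ha _⟩ q) else 0 := by
  rw [Matrix.mul_apply, map_sum, Finset.sum_eq_single ⟨a (i - 1), ha _⟩]
  · simp [Wm, matrixUnitPoint]
  · intro k _ hk
    have hk' : (k : ℕ) ≠ a (i - 1) := fun e => hk (Fin.ext e)
    simp [Wm, matrixUnitPoint, hk']
  · simp

theorem eval_matrixUnitPoint_WmProd_row (n a : ℕ → ℕ) (ha : ∀ i, a i < n i) (b : ℕ) {s t : ℕ}
    (hts : t ≤ s) (q : Fin (n t)) :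
    eval (matrixUnitPoint a b) (WmProd n s t ⟨a s, ha s⟩ q) =
      if (q : ℕ) = a t then 1 else 0 := by
  induction s, hts using Nat.le_induction with
  | base =>
    rw [WmProd, dif_neg (lt_irrefl t), Matrix.of_apply, apply_ite (eval _), map_one, map_zero]
    simp only [eq_comm]
  | succ s hts ih =>
    rw [WmProd, dif_pos (Nat.lt_succ_of_le hts), eval_matrixUnitPoint_Wm_mul n a ha, if_pos rfl]
    exact ih

theorem eval_matrixUnitPoint_WmProd (n a : ℕ → ℕ) (ha : ∀ i, a i < n i) (b : ℕ) {s t : ℕ}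
    (hts : t < s) (p : Fin (n s)) (q : Fin (n t)) :
    eval (matrixUnitPoint a b) (WmProd n s t p q) =
      if (p : ℕ) = a s ∧ (q : ℕ) = a t then 1 else 0 := by
  rw [WmProd, dif_pos hts, eval_matrixUnitPoint_Wm_mul n a ha,
    eval_matrixUnitPoint_WmProd_row n a ha b (Nat.le_sub_one_of_lt hts), ite_and]

/-- Lemma on `[𝐛𝐖]` terms. -/
theorem phi_or_psi_eq_zero_of_bW_combination (L : ℕ) (hL : 1 ≤ L) (n : ℕ → ℕ)
    (hn : ∀ i, 1 ≤ n i)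
    (s t : ℕ) (hs : 0 < s) (hsL : s ≤ L) (htL : t < L)
    (Ψ : Matrix (Fin 1) (Fin (n L)) ℝ)
    (Φ : Fin (n s) → Fin (n t) → ℝ)
    (h : (∑ p, ∑ q, MvPolynomial.C (Φ p q) *
        (bm n s * toR Ψ * WmProd n L t) p q) = (0 : Rpoly)) :
    (∀ p q, Φ p q = 0) ∨ Ψ = 0 := by
  by_contra! hne
  obtain ⟨⟨p₀, q₀, hΦ⟩, hΨ⟩ := hne
  obtain ⟨c, hc⟩ : ∃ c, Ψ 0 c ≠ 0 := by
    by_contra! hzero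
    exact hΨ (Matrix.ext fun i j => by rw [Subsingleton.elim i 0, hzero j, Matrix.zero_apply])
  let a : ℕ → ℕ := fun i => if i = L then c else if i = t then q₀ else 0
  have haL : a L = c := if_pos rfl
  have hat : a t = q₀ := by simp [a, htL.ne]
  have ha : ∀ i, a i < n i := by
    intro i
    by_cases hiL : i = L
    · subst hiL; rw [haL]; exact c.isLt
    by_cases hit : i = t
    · subst hit; rw [hat]; exact q₀.isLt
    · simpa [a, hiL, hit] using Nat.lt_of_succ_le (hn i)
  have hentry : ∀ p q, eval (matrixUnitPoint a p₀) ((bm n s * toR Ψ * WmProd n L t) p q) =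
      if p = p₀ ∧ q = q₀ then Ψ 0 c else 0 := by
    intro p q
    rw [Matrix.mul_apply, map_sum, Finset.sum_eq_single c]
    · rw [map_mul, eval_matrixUnitPoint_WmProd n a ha p₀ htL, haL, hat]
      simp [Matrix.mul_apply, bm, toR, matrixUnitPoint, Fin.val_inj, ite_and]
      split_ifs <;> rfl
    · intro k _ hk
      rw [map_mul, eval_matrixUnitPoint_WmProd n a ha p₀ htL, haL]
      simp [Fin.val_inj, hk]
    · simp
  have heval := congrArg (eval (matrixUnitPoint a p₀)) h
  simp only [map_sum, map_mul, eval_C, hentry, map_zero, ite_and, mul_ite, mul_zero,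
    Finset.sum_ite_irrel, Finset.sum_const_zero, Finset.sum_ite_eq',
    Finset.mem_univ, if_true] at heval
  exact mul_ne_zero hΦ hc heval
end
end

section
/- Let m, n ≥ 1 and let A = (a_{ij}) and B = (b_{ij}) be matrices in ℝ^{m × n}. If a_{ij}·b_{kl} + a_{kj}·b_{il} + a_{il}·b_{kj} + a_{kl}·b_{ij} = 0 for all 1 ≤ i, k ≤ m and 1 ≤ j, l ≤ n, then A = 0 or B = 0. -/
/-- if `a_{ij}·b_{kl} + a_{kj}·b_{il} + a_{il}·b_{kj} + a_{kl}·b_{ij} = 0`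
for all `i, k, j, l`, then `A = 0` or `B = 0`. -/
theorem matrix_zero_of_sym_products_zero (m n : ℕ) (hm : 1 ≤ m) (hn : 1 ≤ n)
    (A B : Matrix (Fin m) (Fin n) ℝ)
    (h : ∀ (i k : Fin m) (j l : Fin n),
      A i j * B k l + A k j * B i l + A i l * B k j + A k l * B i j = 0) :
    A = 0 ∨ B = 0 := by
  refine or_iff_not_imp_left.2 fun hA => ?_
  obtain ⟨i, j, hij⟩ : ∃ i j, A i j ≠ 0 := by
    by_contra! hzero
    exact hA (Matrix.ext hzero)
  have hentry : B i j = 0 := by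
    have : A i j * B i j = 0 := by linarith [h i i j j]
    exact (mul_eq_zero.1 this).resolve_left hij
  have hrow (l : Fin n) : B i l = 0 := by
    have : A i j * B i l = 0 := by
      have := h i i j l
      rw [hentry] at this
      linarith
    exact (mul_eq_zero.1 this).resolve_left hij
  have hcol (k : Fin m) : B k j = 0 := by
    have : A i j * B k j = 0 := by
      have := h i k j j
      rw [hentry] at this
      linarith
    exact (mul_eq_zero.1 this).resolve_left hij
  ext k l
  have := h i k j l
  rw [hentry, hrow l, hcol k] at this
  simpa [hij] using this
end

section
/- Let d ≥ 1 and n_1, …, n_d ≥ 1 be integers, and let A, B ∈ ℝ^{n_1 × n_2 × ⋯ × n_d} be real d-dimensional arrays (i.e. real-valued functions of index tuples (i_1, …, i_d) with 1 ≤ i_j ≤ n_j). Suppose that for every choice of indices i_1^0, i_1^1 ∈ {1, …, n_1}, …, i_d^0, i_d^1 ∈ {1, …, n_d}, one has Σ_{(α_1, …, α_d) ∈ {0,1}^d} A(i_1^{α_1}, …, i_d^{α_d}) · B(i_1^{1−α_1}, …, i_d^{1−α_d}) = 0. Then A = 0 or B = 0. -/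
section MultilinearPolynomial

variable {ι : Type*} {κ : ι → Type*}

/-- Exchange the entries of two index tuples in the positions selected by `α`. -/
def swapTuples (α : ι → Bool) : Equiv.Perm ((∀ j, κ j) × (∀ j, κ j)) :=
  Function.Involutive.toPerm
    (fun p => (fun j => if α j then p.2 j else p.1 j, fun j => if α j then p.1 j else p.2 j))
    (by
      rintro ⟨p, q⟩
      ext j <;> by_cases hj : α j <;> simp [hj])

theorem swapTuples_apply (α : ι → Bool) (p : (∀ j, κ j) × (∀ j, κ j)) :
    swapTuples α p =
      (fun j => if α j then p.2 j else p.1 j, fun j => if α j then p.1 j else p.2 j) :=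
  rfl

variable [Fintype ι] [DecidableEq ι] [∀ j, Fintype (κ j)] {R : Type*} [CommRing R]

/-- The multilinear polynomial in the variables `x_{j, k}` whose coefficients are the entries
of the array `A`. -/
noncomputable def multilinearPolynomial (A : (∀ j, κ j) → R) : MvPolynomial (Σ j, κ j) R :=
  ∑ i, MvPolynomial.C (A i) * ∏ j, MvPolynomial.X ⟨j, i j⟩

theorem eval_multilinearPolynomial_indicator [∀ j, DecidableEq (κ j)] (A : (∀ j, κ j) → R)
    (i : ∀ j, κ j) :
    MvPolynomial.eval (fun s => if s.2 = i s.1 then 1 else 0) (multilinearPolynomial A) = A i := by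
  simp only [multilinearPolynomial, map_sum, map_mul, map_prod, MvPolynomial.eval_C,
    MvPolynomial.eval_X]
  rw [Finset.sum_eq_single i]
  · simp
  · intro p _ hp
    obtain ⟨j, hj⟩ := Function.ne_iff.mp hp
    rw [Finset.prod_eq_zero (Finset.mem_univ j) (if_neg hj), mul_zero]
  · simp

theorem multilinearPolynomial_eq_zero_iff (A : (∀ j, κ j) → R) :
    multilinearPolynomial A = 0 ↔ A = 0 := by
  classical
  refine ⟨fun hA => ?_, fun hA => by simp [hA, multilinearPolynomial]⟩
  ext i
  rw [← eval_multilinearPolynomial_indicator A i, hA, map_zero, Pi.zero_apply]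

theorem multilinearPolynomial_mul (A B : (∀ j, κ j) → R) :
    multilinearPolynomial A * multilinearPolynomial B =
      ∑ p : (∀ j, κ j) × (∀ j, κ j), MvPolynomial.C (A p.1 * B p.2) *
        ∏ j, (MvPolynomial.X ⟨j, p.1 j⟩ * MvPolynomial.X ⟨j, p.2 j⟩) := by
  rw [multilinearPolynomial, multilinearPolynomial, Finset.sum_mul_sum, Fintype.sum_prod_type]
  refine Finset.sum_congr rfl fun p _ => Finset.sum_congr rfl fun q _ => ?_
  rw [Finset.prod_mul_distrib, map_mul]
  ring

theorem multilinearPolynomial_mul_eq_sum_swap (A B : (∀ j, κ j) → R) (α : ι → Bool) :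
    multilinearPolynomial A * multilinearPolynomial B =
      ∑ p : (∀ j, κ j) × (∀ j, κ j),
        MvPolynomial.C (A (fun j => if α j then p.2 j else p.1 j) *
          B (fun j => if α j then p.1 j else p.2 j)) *
        ∏ j, (MvPolynomial.X ⟨j, p.1 j⟩ * MvPolynomial.X ⟨j, p.2 j⟩) := by
  rw [multilinearPolynomial_mul, ← Equiv.sum_comp (swapTuples α)]
  refine Finset.sum_congr rfl fun p _ => ?_
  congr 1
  refine Finset.prod_congr rfl fun j _ => ?_
  by_cases hj : α j <;> simp [swapTuples_apply, hj, mul_comm]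

theorem card_smul_multilinearPolynomial_mul (A B : (∀ j, κ j) → R) :
    Fintype.card (ι → Bool) • (multilinearPolynomial A * multilinearPolynomial B) =
      ∑ p : (∀ j, κ j) × (∀ j, κ j),
        MvPolynomial.C (∑ α : ι → Bool, A (fun j => if α j then p.2 j else p.1 j) *
          B (fun j => if α j then p.1 j else p.2 j)) *
        ∏ j, (MvPolynomial.X ⟨j, p.1 j⟩ * MvPolynomial.X ⟨j, p.2 j⟩) := by
  simp_rw [map_sum, Finset.sum_mul]
  rw [Finset.sum_comm, ← Finset.card_univ, ← Finset.sum_const]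
  exact Finset.sum_congr rfl fun α _ => multilinearPolynomial_mul_eq_sum_swap A B α

end MultilinearPolynomial

/-- the `d`-dimensional version.  If for all pairs of index tuples
`i⁰, i¹` the symmetrized sum `Σ_{α ∈ {0,1}^d} A(i^α)·B(i^{1-α}) = 0`, then `A = 0` or `B = 0`.
Here `i^α` denotes the tuple whose `j`-th component is `i^{α_j}_j`. -/
theorem tensor_zero_of_sym_products_zero (d : ℕ) (hd : 1 ≤ d)
    (nn : Fin d → ℕ) (hnn : ∀ j, 1 ≤ nn j)
    (A B : (∀ j : Fin d, Fin (nn j)) → ℝ)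
    (h : ∀ i0 i1 : ∀ j : Fin d, Fin (nn j),
      ∑ α : Fin d → Bool,
        A (fun j => if α j then i1 j else i0 j) * B (fun j => if α j then i0 j else i1 j) = 0) :
    A = 0 ∨ B = 0 := by
  have hmul : multilinearPolynomial A * multilinearPolynomial B = 0 := by
    refine (smul_eq_zero.mp ?_).resolve_left (Fintype.card_ne_zero (α := Fin d → Bool))
    rw [card_smul_multilinearPolynomial_mul]
    exact Finset.sum_eq_zero fun p _ => by rw [h, map_zero, zero_mul]
  exact (mul_eq_zero.mp hmul).imp (multilinearPolynomial_eq_zero_iff A).mp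
    (multilinearPolynomial_eq_zero_iff B).mp
end
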